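/- arXiv:1609.01652 — 2 statements merged into one kernel-verified Lean document; each statement's English description precedes it below -/
import Mathlib

section
/- Let X, Z be balanced observables on a finite-dimensional Hilbert space H_A of even dimension, and let |ψ⟩ be a unit vector in H_A ⊗ H_B such that ‖({X,Z} ⊗ Id)|ψ⟩‖ ≤ ε. Then there exists a balanced observable Z̃ on H_A such that {X, Z̃} = 0 and ‖((Z − Z̃) ⊗ Id)|ψ⟩‖ ≤ √(3/2)·ε. -/
open Matrix Kronecker

/-- An observable (Hermitian, squaring to the identity) is *balanced* if its
`+1`-eigenspace and its `−1`-eigenspace have the same dimension. -/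
noncomputable def balanced {d : ℕ} (M : Matrix (Fin d) (Fin d) ℂ) : Prop :=
  Module.finrank ℂ (Module.End.eigenspace (Matrix.toLin' M) 1) =
  Module.finrank ℂ (Module.End.eigenspace (Matrix.toLin' M) (-1))

lemma aux_balanced_iff {d : ℕ} (M : Matrix (Fin d) (Fin d) ℂ) (hM : M * M = 1) :
    balanced M ↔ M.trace = 0 := by
  have key : ∀ c : ℂ, c * c = 1 →
      ((Module.finrank ℂ (Module.End.eigenspace (Matrix.toLin' M) c) : ℕ) : ℂ)
        = (1 / 2 : ℂ) * (d + c * M.trace) := by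
    intro c hc
    have hp : LinearMap.IsProj (Module.End.eigenspace (Matrix.toLin' M) c)
        (Matrix.toLin' ((1 / 2 : ℂ) • (1 + c • M))) := by
      constructor
      · intro x
        rw [Module.End.mem_eigenspace_iff]
        simp only [Matrix.toLin'_apply, Matrix.smul_mulVec, Matrix.add_mulVec, Matrix.one_mulVec,
          Matrix.mulVec_smul, Matrix.mulVec_add, Matrix.mulVec_mulVec, hM]
        simp only [smul_add, smul_smul]
        rw [show c * (1 / 2 * c) = 1 / 2 by linear_combination (1/2) * hc]
        rw [add_comm]
        congr 2
        ring
      · intro x hx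
        rw [Module.End.mem_eigenspace_iff] at hx
        simp only [Matrix.toLin'_apply] at hx
        simp only [Matrix.toLin'_apply, Matrix.smul_mulVec, Matrix.add_mulVec, Matrix.one_mulVec,
          hx, smul_smul, hc, one_smul]
        rw [← two_smul ℂ, smul_smul]
        norm_num
    have := hp.trace
    rw [← this, Matrix.trace_toLin'_eq]
    simp [Matrix.trace_smul, Matrix.trace_add]
    ring
  unfold balanced
  have h1 := key 1 (by norm_num)
  have h2 := key (-1) (by norm_num)
  rw [← Nat.cast_inj (R := ℂ), h1, h2]
  constructor
  · intro h
    linear_combination h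
  · intro h
    rw [h]
    ring

lemma aux_partial {d : ℕ} (P Q : Matrix (Fin d) (Fin d) ℂ) (hP : P.IsHermitian)
    (hQ : Q.IsHermitian) (hP2 : P * P = P) (hQ2 : Q * Q = Q) (ht : P.trace = Q.trace) :
    ∃ V : Matrix (Fin d) (Fin d) ℂ, Vᴴ * V = P ∧ V * Vᴴ = Q ∧ V * P = V ∧ Q * V = V := by
  have h01 : ∀ (A : Matrix (Fin d) (Fin d) ℂ) (hA : A.IsHermitian), A * A = A →
      ∀ i, hA.eigenvalues i = 0 ∨ hA.eigenvalues i = 1 := by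
    intro A hA hA2 i
    have hi : IsIdempotentElem A := hA2
    have := hi.spectrum_subset ℝ (hA.eigenvalues_mem_spectrum_real i)
    simpa using this
  have htr : ∀ (A : Matrix (Fin d) (Fin d) ℂ) (hA : A.IsHermitian), A * A = A →
      A.trace = ((Fintype.card {i // hA.eigenvalues i = 1} : ℕ) : ℂ) := by
    intro A hA hA2
    rw [hA.trace_eq_sum_eigenvalues, Fintype.card_subtype, Finset.card_filter]
    push_cast
    refine Finset.sum_congr rfl fun i _ => ?_
    rcases h01 A hA hA2 i with h | h <;> simp [h]
  have hcard : Fintype.card {i // hP.eigenvalues i = 1} =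
      Fintype.card {i // hQ.eigenvalues i = 1} := by
    have := ht
    rw [htr P hP hP2, htr Q hQ hQ2] at this
    exact_mod_cast this
  let e := (Fintype.equivOfCardEq hcard).extendSubtype
  have he : ∀ i, hQ.eigenvalues (e i) = hP.eigenvalues i := by
    intro i
    by_cases h : hP.eigenvalues i = 1
    · rw [h]
      exact (Fintype.equivOfCardEq hcard).extendSubtype_mem i h
    · have h' := (Fintype.equivOfCardEq hcard).extendSubtype_not_mem i h
      rw [((h01 P hP hP2 i).resolve_right h), ((h01 Q hQ hQ2 _).resolve_right h')]
  obtain ⟨T, hT1, hTP⟩ : ∃ T : Matrix (Fin d) (Fin d) ℂ, Tᴴ * T = 1 ∧ T * P * Tᴴ = Q := by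
    have sP := hP.spectral_theorem
    have sQ := hQ.spectral_theorem
    rw [Unitary.conjStarAlgAut_apply] at sP sQ
    set U := hP.eigenvectorUnitary
    set W := hQ.eigenvectorUnitary
    have hU : (U : Matrix (Fin d) (Fin d) ℂ)ᴴ * U = 1 := Unitary.coe_star_mul_self U
    have hU' : (U : Matrix (Fin d) (Fin d) ℂ) * (U : Matrix (Fin d) (Fin d) ℂ)ᴴ = 1 :=
      Unitary.coe_mul_star_self U
    have hW : (W : Matrix (Fin d) (Fin d) ℂ)ᴴ * W = 1 := Unitary.coe_star_mul_self W
    let σ : Matrix (Fin d) (Fin d) ℂ := (1 : Matrix (Fin d) (Fin d) ℂ).submatrix e.symm id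
    have hσ : σᴴ * σ = 1 := by
      simp only [σ, conjTranspose_submatrix, conjTranspose_one]
      rw [Matrix.submatrix_mul_equiv]
      simp
    have hσd : σ * diagonal (RCLike.ofReal ∘ hP.eigenvalues : Fin d → ℂ) * σᴴ =
        diagonal (RCLike.ofReal ∘ hQ.eigenvalues : Fin d → ℂ) := by
      ext i j
      simp only [σ, Matrix.mul_diagonal, Matrix.mul_apply (M := _ * _), conjTranspose_apply, submatrix_apply,
        id, one_apply, diagonal_apply]
      rw [Finset.sum_eq_single (e.symm i)]
      · by_cases hij : i = j
        · subst hij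
          have := he (e.symm i)
          simp at this
          simp [this]
        · have : e.symm j ≠ e.symm i := fun h => hij (e.symm.injective h).symm
          simp [hij, this]
      · intro b _ hb
        simp [hb.symm]
      · simp
    refine ⟨(W : Matrix (Fin d) (Fin d) ℂ) * σ * (U : Matrix (Fin d) (Fin d) ℂ)ᴴ, ?_, ?_⟩
    · simp only [conjTranspose_mul, conjTranspose_conjTranspose]
      calc _ = (U : Matrix (Fin d) (Fin d) ℂ) * (σᴴ * ((W : Matrix (Fin d) (Fin d) ℂ)ᴴ * W) * σ) * (U : Matrix (Fin d) (Fin d) ℂ)ᴴ := by noncomm_ring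
        _ = 1 := by rw [hW, Matrix.mul_one, hσ, Matrix.mul_one, hU']
    · simp only [conjTranspose_mul, conjTranspose_conjTranspose]
      rw [sP, sQ, ← hσd]
      simp only [star_eq_conjTranspose]
      calc _ = (W : Matrix (Fin d) (Fin d) ℂ) * σ * ((U : Matrix (Fin d) (Fin d) ℂ)ᴴ * U) * diagonal (RCLike.ofReal ∘ hP.eigenvalues : Fin d → ℂ) * ((U : Matrix (Fin d) (Fin d) ℂ)ᴴ * U) * σᴴ * (W : Matrix (Fin d) (Fin d) ℂ)ᴴ := by noncomm_ring
        _ = _ := by rw [hU]; noncomm_ring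
  have hPh : Pᴴ = P := hP
  refine ⟨T * P, ?_, ?_, ?_, ?_⟩
  · rw [conjTranspose_mul, hPh]
    calc _ = P * (Tᴴ * T) * P := by noncomm_ring
      _ = P := by rw [hT1, Matrix.mul_one, hP2]
  · rw [conjTranspose_mul, hPh]
    calc _ = T * (P * P) * Tᴴ := by noncomm_ring
      _ = Q := by rw [hP2, hTP]
  · rw [Matrix.mul_assoc, hP2]
  · rw [← hTP]
    calc _ = T * (P * (Tᴴ * T) * P) := by noncomm_ring
      _ = _ := by rw [hT1, Matrix.mul_one, hP2]

open scoped MatrixOrder ComplexOrder in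
lemma aux_cfc {d : ℕ} (A : Matrix (Fin d) (Fin d) ℂ) (hA : A.PosSemidef) :
    ∃ G : Matrix (Fin d) (Fin d) ℂ, Gᴴ = G ∧ (∀ Y, Commute A Y → Commute G Y) ∧
      (A * G).PosSemidef ∧ A * G * G * A = A := by
  have hs : IsSelfAdjoint A := hA.1
  have hc : ∀ f : ℝ → ℝ, ContinuousOn f (spectrum ℝ A) := fun f =>
    (Matrix.finite_real_spectrum).continuousOn f
  have hnn : ∀ x ∈ spectrum ℝ A, 0 ≤ x := fun x hx =>
    spectrum_nonneg_of_nonneg hA.nonneg hx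
  have hid : cfc (fun x : ℝ => x) A = A := cfc_id' ℝ A
  have hAG : A * cfc (fun x : ℝ => (Real.sqrt x)⁻¹) A = cfc (fun x : ℝ => x * (Real.sqrt x)⁻¹) A := by
    rw [cfc_mul (fun x : ℝ => x) _ A (hc _) (hc _), hid]
  refine ⟨cfc (fun x : ℝ => (Real.sqrt x)⁻¹) A, ?_, ?_, ?_, ?_⟩
  · exact (IsSelfAdjoint.cfc (R := ℝ) (f := fun x : ℝ => (Real.sqrt x)⁻¹) (a := A))
  · intro Y hY
    exact hY.cfc_real _
  · rw [hAG, ← Matrix.nonneg_iff_posSemidef]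
    refine cfc_nonneg fun x hx => ?_
    have := hnn x hx
    positivity
  · rw [hAG, ← cfc_mul _ _ A (hc _) (hc _)]
    conv_lhs => rw [← hid]
    conv_lhs => 
      rw [hid]
      arg 2
      rw [← hid]
    rw [← cfc_mul _ _ A (hc _) (hc _)]
    conv_rhs => rw [← hid]
    refine cfc_congr fun x hx => ?_
    have h0 := hnn x hx
    rcases h0.eq_or_lt with h | h
    · simp [← h]
    · have h1 := Real.sq_sqrt h0
      have h2 : Real.sqrt x ≠ 0 := (Real.sqrt_pos.mpr h).ne'
      field_simp
      linear_combination (-1 : ℝ) * h1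

open scoped ComplexOrder in
lemma aux_norm {d k : ℕ} (M N : Matrix (Fin d) (Fin d) ℂ) (h : (Nᴴ * N - Mᴴ * M).PosSemidef)
    (ψ : EuclideanSpace ℂ (Fin d × Fin k)) :
    ‖Matrix.toEuclideanLin (M ⊗ₖ (1 : Matrix (Fin k) (Fin k) ℂ)) ψ‖ ≤
    ‖Matrix.toEuclideanLin (N ⊗ₖ (1 : Matrix (Fin k) (Fin k) ℂ)) ψ‖ := by
  have hk := h.kronecker (Matrix.PosSemidef.one (n := Fin k) (R := ℂ))
  have h2 := (Matrix.posSemidef_iff_dotProduct_mulVec.mp hk).2 ψ.ofLp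
  have hn : ∀ L : Matrix (Fin d) (Fin d) ℂ,
      star ψ.ofLp ⬝ᵥ ((Lᴴ * L) ⊗ₖ (1 : Matrix (Fin k) (Fin k) ℂ)) *ᵥ ψ.ofLp
      = ((‖Matrix.toEuclideanLin (L ⊗ₖ (1 : Matrix (Fin k) (Fin k) ℂ)) ψ‖ ^ 2 : ℝ) : ℂ) := by
    intro L
    have : (Lᴴ * L) ⊗ₖ (1 : Matrix (Fin k) (Fin k) ℂ) =
        (L ⊗ₖ (1 : Matrix (Fin k) (Fin k) ℂ))ᴴ * (L ⊗ₖ (1 : Matrix (Fin k) (Fin k) ℂ)) := by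
      rw [conjTranspose_kronecker, ← mul_kronecker_mul]
      simp
    rw [this, ← Matrix.mulVec_mulVec, Matrix.dotProduct_mulVec, ← Matrix.star_mulVec]
    have h3 := inner_self_eq_norm_sq_to_K (𝕜 := ℂ) (Matrix.toEuclideanLin (L ⊗ₖ (1 : Matrix (Fin k) (Fin k) ℂ)) ψ)
    rw [EuclideanSpace.inner_eq_star_dotProduct] at h3
    push_cast
    rw [dotProduct_comm]
    exact h3
  rw [show Nᴴ * N - Mᴴ * M = Nᴴ * N + (-1 : ℂ) • (Mᴴ * M) by simp [sub_eq_add_neg],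
    add_kronecker, smul_kronecker, Matrix.add_mulVec, dotProduct_add, Matrix.smul_mulVec,
    dotProduct_smul, hn, hn] at h2
  have h4 : (0 : ℝ) ≤ ‖Matrix.toEuclideanLin (N ⊗ₖ (1 : Matrix (Fin k) (Fin k) ℂ)) ψ‖ ^ 2 - 
      ‖Matrix.toEuclideanLin (M ⊗ₖ (1 : Matrix (Fin k) (Fin k) ℂ)) ψ‖ ^ 2 := by
    rw [← Complex.zero_le_real]
    convert h2 using 1
    push_cast
    simp [sub_eq_add_neg]
  exact le_of_sq_le_sq (by linarith) (norm_nonneg _)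

open scoped ComplexOrder in
/-- A Hermitian `O` anticommuting with a traceless observable `X` has a polar decomposition with an
observable anticommuting with `X`. -/
lemma aux_polar {d : ℕ} (X O : Matrix (Fin d) (Fin d) ℂ) (hX : Xᴴ = X) (hX2 : X * X = 1)
    (htX : X.trace = 0) (hO : Oᴴ = O) (hXO : X * O = -(O * X)) :
    ∃ T : Matrix (Fin d) (Fin d) ℂ, Tᴴ = T ∧ T * T = 1 ∧ X * T = -(T * X) ∧
      (T * O).PosSemidef := by
  have hA : (O * O).PosSemidef := by
    have := Matrix.posSemidef_conjTranspose_mul_self O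
    rwa [hO] at this
  obtain ⟨G, hG, hGc, hGp, hGA⟩ := aux_cfc (O * O) hA
  have hGO : G * O = O * G := hGc O ((Commute.refl O).mul_left (Commute.refl O))
  have hXOO : (O * O) * X = X * (O * O) := by
    rw [← Matrix.mul_assoc, hXO, Matrix.neg_mul, Matrix.mul_assoc, Matrix.mul_assoc, hXO]
    simp
  have hGX : G * X = X * G := hGc X hXOO
  -- the sign of O
  obtain ⟨S, hS⟩ : ∃ S, S = O * G := ⟨_, rfl⟩
  have hSh : Sᴴ = S := by rw [hS, conjTranspose_mul, hG, hO, hGO]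
  have hXS : X * S = -(S * X) := by
    rw [hS, ← Matrix.mul_assoc, hXO, Matrix.neg_mul, Matrix.mul_assoc, ← hGX, Matrix.mul_assoc]
  have hSO : S * O = O * S := by rw [hS, Matrix.mul_assoc, hGO]
  have hSSO : S * S * O * O = O * O := by
    have h1 : O * O * G * G * (O * O) = O * O * (O * O * G * G) := by
      have : Commute (O * O * G * G) (O * O) := by
        have c1 : Commute G (O * O) := hGc _ (Commute.refl _)
        exact (((Commute.refl (O * O)).mul_left c1).mul_left c1)
      exact this
    calc S * S * O * O = O * (G * O) * G * O * O := by rw [hS]; noncomm_ring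
      _ = O * O * G * G * (O * O) := by rw [hGO]; noncomm_ring
      _ = O * O := hGA
  obtain ⟨P, hP⟩ : ∃ P, P = 1 - S * S := ⟨_, rfl⟩
  have hPh : Pᴴ = P := by rw [hP]; simp [conjTranspose_sub, conjTranspose_mul, hSh]
  have hPOO : P * (O * O) = 0 := by
    rw [hP, Matrix.sub_mul, Matrix.one_mul, ← Matrix.mul_assoc, hSSO, sub_self]
  have hPO : P * O = 0 := by
    rw [← Matrix.self_mul_conjTranspose_eq_zero, conjTranspose_mul, hPh, hO]
    calc P * O * (O * P) = P * (O * O) * P := by noncomm_ring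
      _ = 0 := by rw [hPOO, Matrix.zero_mul]
  have hPS : P * S = 0 := by rw [hS, ← Matrix.mul_assoc, hPO, Matrix.zero_mul]
  have hSP : S * P = 0 := by
    have := congrArg conjTranspose hPS
    simpa [conjTranspose_mul, hPh, hSh] using this
  have hPP : P * P = P := by
    nth_rewrite 2 [hP]
    rw [Matrix.mul_sub, ← Matrix.mul_assoc, hPS]; simp
  have hXSS : X * (S * S) = S * S * X := by
    rw [← Matrix.mul_assoc, hXS, Matrix.neg_mul, Matrix.mul_assoc, hXS]; simp [Matrix.mul_assoc]
  have hXP : X * P = P * X := by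
    rw [hP, Matrix.mul_sub, Matrix.sub_mul, hXSS]; simp
  have htXP : (P * X).trace = 0 := by
    have h1 : (S * S * X).trace = -(S * S * X).trace := by
      conv_lhs => rw [Matrix.mul_assoc, Matrix.trace_mul_comm, Matrix.mul_assoc, hXS]
      rw [Matrix.mul_neg, Matrix.trace_neg, Matrix.mul_assoc]
    have h2 : (S * S * X).trace = 0 := self_eq_neg.mp h1
    rw [hP, Matrix.sub_mul, Matrix.trace_sub, h2, Matrix.one_mul, htX, sub_zero]
  have hPXPX : P * X * (P * X) = P := by
    calc P * X * (P * X) = P * (X * P) * X := by noncomm_ring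
      _ = P * P * (X * X) := by rw [hXP]; noncomm_ring
      _ = P := by rw [hPP, hX2, Matrix.mul_one]
  have hPPX : P * (P * X) = P * X := by rw [← Matrix.mul_assoc, hPP]
  have hPXP : P * X * P = P * X := by rw [Matrix.mul_assoc, hXP, hPPX]
  have hPXh : (P * X)ᴴ = P * X := by rw [conjTranspose_mul, hX, hPh, hXP]
  obtain ⟨Q, hQ⟩ : ∃ Q, Q = (1 / 2 : ℂ) • (P + P * X) := ⟨_, rfl⟩
  obtain ⟨N, hN⟩ : ∃ N, N = (1 / 2 : ℂ) • (P - P * X) := ⟨_, rfl⟩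
  have hQh : Qᴴ = Q := by
    rw [hQ, conjTranspose_smul, conjTranspose_add, hPh, hPXh]; simp
  have hNh : Nᴴ = N := by
    rw [hN, conjTranspose_smul, conjTranspose_sub, hPh, hPXh]; simp
  have hQQ : Q * Q = Q := by
    rw [hQ]
    simp only [Matrix.smul_mul, Matrix.mul_smul, Matrix.mul_add, Matrix.add_mul, hPP, hPXPX, hPPX,
      hPXP]
    module
  have hNN : N * N = N := by
    rw [hN]
    simp only [Matrix.smul_mul, Matrix.mul_smul, Matrix.mul_sub, Matrix.sub_mul, hPP, hPXPX, hPPX,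
      hPXP]
    module
  have hQN : Q * N = 0 := by
    rw [hN, hQ]
    simp only [Matrix.smul_mul, Matrix.mul_smul, Matrix.mul_sub, Matrix.add_mul, hPP, hPXPX, hPPX,
      hPXP]
    module
  have hQaN : Q + N = P := by rw [hQ, hN]; module
  have hQP : Q * P = Q := by rw [← hQaN, Matrix.mul_add, hQQ, hQN, add_zero]
  have hPN : P * N = N := by rw [← hQaN, Matrix.add_mul, hNN, hQN, zero_add]
  have hQX : Q * X = Q := by
    rw [hQ, Matrix.smul_mul, Matrix.add_mul, Matrix.mul_assoc P X X, hX2, Matrix.mul_one]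
    module
  have hXN : X * N = -N := by
    rw [hN, Matrix.mul_smul, Matrix.mul_sub, ← Matrix.mul_assoc, hXP, Matrix.mul_assoc P X X, hX2,
      Matrix.mul_one]
    module
  have htr : Q.trace = N.trace := by
    rw [hQ, hN, Matrix.trace_smul, Matrix.trace_smul, Matrix.trace_add, Matrix.trace_sub, htXP]
    simp
  obtain ⟨V, hV1, hV2, hVQ, hNV⟩ := aux_partial Q N hQh hNh hQQ hNN htr
  have hVV : V * V = 0 := by
    calc V * V = V * Q * (N * V) := by rw [hVQ, hNV]
      _ = V * (Q * N) * V := by noncomm_ring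
      _ = 0 := by rw [hQN]; simp
  have hXV : X * V = -V := by rw [← hNV, ← Matrix.mul_assoc, hXN, Matrix.neg_mul]
  have hVX : V * X = V := by rw [← hVQ, Matrix.mul_assoc, hQX]
  have hVP : V * P = V := by rw [← hVQ, Matrix.mul_assoc, hQP]
  have hPV : P * V = V := by rw [← hNV, ← Matrix.mul_assoc, hPN]
  obtain ⟨W, hW⟩ : ∃ W, W = V + Vᴴ := ⟨_, rfl⟩
  have hWh : Wᴴ = W := by rw [hW, conjTranspose_add, conjTranspose_conjTranspose, add_comm]
  have hVVh : Vᴴ * Vᴴ = 0 := by rw [← conjTranspose_mul, hVV, conjTranspose_zero]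
  have hWW : W * W = P := by
    rw [hW, Matrix.mul_add, Matrix.add_mul, Matrix.add_mul, hVV, hVVh, hV1, hV2, ← hQaN]
    simp
  have hXVh : X * Vᴴ = Vᴴ := by
    have := congrArg conjTranspose hVX
    rwa [conjTranspose_mul, hX] at this
  have hVhX : Vᴴ * X = -Vᴴ := by
    have := congrArg conjTranspose hXV
    rwa [conjTranspose_mul, hX, conjTranspose_neg] at this
  have hXW : X * W = -(W * X) := by
    rw [hW, Matrix.mul_add, Matrix.add_mul, hXV, hXVh, hVX, hVhX]; abel
  have hWP : W * P = W := by
    have := congrArg conjTranspose hPV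
    rw [conjTranspose_mul, hPh] at this
    rw [hW, Matrix.add_mul, hVP, this]
  have hPW : P * W = W := by
    have := congrArg conjTranspose hWP
    rwa [conjTranspose_mul, hPh, hWh] at this
  have hWS : W * S = 0 := by rw [← hWP, Matrix.mul_assoc, hPS, Matrix.mul_zero]
  have hSW : S * W = 0 := by rw [← hPW, ← Matrix.mul_assoc, hSP, Matrix.zero_mul]
  have hWO : W * O = 0 := by rw [← hWP, Matrix.mul_assoc, hPO, Matrix.mul_zero]
  refine ⟨S + W, ?_, ?_, ?_, ?_⟩
  · rw [conjTranspose_add, hSh, hWh]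
  · rw [Matrix.mul_add, Matrix.add_mul, Matrix.add_mul, hWS, hSW, hWW, hP]; abel
  · rw [Matrix.mul_add, Matrix.add_mul, hXS, hXW]; abel
  · rw [Matrix.add_mul, hWO, add_zero, hSO, hS, ← Matrix.mul_assoc]
    exact hGp

/-- Approximately anticommuting balanced observables can be
corrected to exactly anticommuting ones, with error at most `√(3/2)·ε` on the
state. -/
theorem stmt2 {m k : ℕ} (X Z : Matrix (Fin (2 * m)) (Fin (2 * m)) ℂ)
    (hXh : X.IsHermitian) (hX2 : X * X = 1) (hXb : balanced X)
    (hZh : Z.IsHermitian) (hZ2 : Z * Z = 1) (hZb : balanced Z)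
    (ψ : EuclideanSpace ℂ (Fin (2 * m) × Fin k)) (hψ : ‖ψ‖ = 1)
    (ε : ℝ)
    (hac : ‖Matrix.toEuclideanLin ((X * Z + Z * X) ⊗ₖ (1 : Matrix (Fin k) (Fin k) ℂ)) ψ‖ ≤ ε) :
    ∃ Zt : Matrix (Fin (2 * m)) (Fin (2 * m)) ℂ,
      Zt.IsHermitian ∧ Zt * Zt = 1 ∧ balanced Zt ∧ X * Zt + Zt * X = 0 ∧
      ‖Matrix.toEuclideanLin ((Z - Zt) ⊗ₖ (1 : Matrix (Fin k) (Fin k) ℂ)) ψ‖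
        ≤ Real.sqrt (3 / 2) * ε := by
  have hXh' : Xᴴ = X := hXh
  have hZh' : Zᴴ = Z := hZh
  obtain ⟨C, hC⟩ : ∃ C, C = (1 / 2 : ℂ) • (Z + X * Z * X) := ⟨_, rfl⟩
  obtain ⟨O, hO⟩ : ∃ O, O = (1 / 2 : ℂ) • (Z - X * Z * X) := ⟨_, rfl⟩
  have hXZXh : (X * Z * X)ᴴ = X * Z * X := by
    rw [conjTranspose_mul, conjTranspose_mul, hXh', hZh', Matrix.mul_assoc]
  have hCh : Cᴴ = C := by
    rw [hC, conjTranspose_smul, conjTranspose_add, hZh', hXZXh]; simp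
  have hOh : Oᴴ = O := by
    rw [hO, conjTranspose_smul, conjTranspose_sub, hZh', hXZXh]; simp
  have e1 : X * (X * Z * X) = Z * X := by
    rw [← Matrix.mul_assoc, ← Matrix.mul_assoc, hX2, Matrix.one_mul]
  have e2 : X * Z * X * X = X * Z := by rw [Matrix.mul_assoc, hX2, Matrix.mul_one]
  have hXO : X * O = -(O * X) := by
    rw [hO, Matrix.mul_smul, Matrix.smul_mul, Matrix.mul_sub, Matrix.sub_mul, e1, e2]
    module
  have hXC : X * Z + Z * X = (2 : ℂ) • (X * C) := by
    rw [hC, Matrix.mul_smul, Matrix.mul_add, e1]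
    module
  have e3 : X * Z * X * (X * Z * X) = 1 := by
    calc X * Z * X * (X * Z * X) = X * Z * (X * X) * Z * X := by noncomm_ring
      _ = X * (Z * Z) * X := by rw [hX2]; noncomm_ring
      _ = 1 := by rw [hZ2, Matrix.mul_one, hX2]
  have hCO : C * C + O * O = 1 := by
    rw [hC, hO]
    simp only [Matrix.smul_mul, Matrix.mul_smul, Matrix.mul_add, Matrix.add_mul, Matrix.mul_sub,
      Matrix.sub_mul, hZ2, e3]
    module
  have hZCO : Z = C + O := by rw [hC, hO]; module
  obtain ⟨T, hTh, hT2, hXT, hTO⟩ :=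
    aux_polar X O hXh' hX2 ((aux_balanced_iff X hX2).mp hXb) hOh hXO
  have htT : T.trace = 0 := by
    have h1 : T.trace = -T.trace := by
      calc T.trace = (X * (X * T)).trace := by rw [← Matrix.mul_assoc, hX2, Matrix.one_mul]
        _ = -(X * (T * X)).trace := by rw [hXT, Matrix.mul_neg, Matrix.trace_neg]
        _ = -T.trace := by
          rw [Matrix.trace_mul_comm, Matrix.mul_assoc, hX2, Matrix.mul_one]
    exact self_eq_neg.mp h1
  refine ⟨T, hTh, hT2, (aux_balanced_iff T hT2).mpr htT, by rw [hXT]; abel, ?_⟩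
  obtain ⟨R, hR⟩ : ∃ R, R = T * O := ⟨_, rfl⟩
  rw [← hR] at hTO
  have hRh : Rᴴ = R := hTO.1
  have hOT : O * T = R := by
    have := hRh
    rwa [hR, conjTranspose_mul, hTh, hOh, ← hR] at this
  have hRR : R * R = O * O := by
    calc R * R = O * T * (T * O) := by rw [hOT, ← hR]
      _ = O * (T * T) * O := by noncomm_ring
      _ = O * O := by rw [hT2, Matrix.mul_one]
  have hCC : C * C = 1 - R * R := by rw [hRR, ← hCO]; abel
  have hOT2 : (O - T)ᴴ * (O - T) = (1 - R) * (1 - R) := by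
    rw [conjTranspose_sub, hOh, hTh, Matrix.sub_mul, Matrix.mul_sub, Matrix.mul_sub, hT2, hOT, ← hR,
      ← hRR]
    noncomm_ring
  open scoped ComplexOrder in
  have b1 : ‖Matrix.toEuclideanLin ((O - T) ⊗ₖ (1 : Matrix (Fin k) (Fin k) ℂ)) ψ‖ ≤
      ‖Matrix.toEuclideanLin ((C * C) ⊗ₖ (1 : Matrix (Fin k) (Fin k) ℂ)) ψ‖ := by
    apply aux_norm
    have h1 : (R + R + Rᴴ * R).PosSemidef :=
      (hTO.add hTO).add (Matrix.posSemidef_conjTranspose_mul_self R)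
    have h2 := h1.conjTranspose_mul_mul_same (1 - R)
    convert h2 using 1
    rw [hOT2, conjTranspose_mul, hCh, hCC, conjTranspose_sub, conjTranspose_one, hRh]
    noncomm_ring
  open scoped ComplexOrder in
  have b2 : ‖Matrix.toEuclideanLin ((C * C) ⊗ₖ (1 : Matrix (Fin k) (Fin k) ℂ)) ψ‖ ≤
      ‖Matrix.toEuclideanLin (C ⊗ₖ (1 : Matrix (Fin k) (Fin k) ℂ)) ψ‖ := by
    apply aux_norm
    have h2 := Matrix.posSemidef_conjTranspose_mul_self (O * C)
    convert h2 using 1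
    rw [conjTranspose_mul, conjTranspose_mul, hCh, hOh]
    calc C * C - C * C * (C * C) = C * (1 - C * C) * C := by noncomm_ring
      _ = C * (O * O) * C := by rw [← hCO]; noncomm_ring
      _ = _ := by noncomm_ring
  open scoped ComplexOrder in
  have b3 : ‖Matrix.toEuclideanLin (((2 : ℂ) • C) ⊗ₖ (1 : Matrix (Fin k) (Fin k) ℂ)) ψ‖ ≤
      ‖Matrix.toEuclideanLin ((X * Z + Z * X) ⊗ₖ (1 : Matrix (Fin k) (Fin k) ℂ)) ψ‖ := by
    apply aux_norm
    convert Matrix.PosSemidef.zero (n := Fin (2 * m)) (R := ℂ) using 1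
    rw [hXC, conjTranspose_smul, conjTranspose_smul, conjTranspose_mul, hCh, hXh']
    simp only [Matrix.smul_mul, Matrix.mul_smul]
    rw [show C * X * (X * C) = C * (X * X) * C by noncomm_ring, hX2, Matrix.mul_one, sub_self]
  have b4 : ‖Matrix.toEuclideanLin (((2 : ℂ) • C) ⊗ₖ (1 : Matrix (Fin k) (Fin k) ℂ)) ψ‖ =
      2 * ‖Matrix.toEuclideanLin (C ⊗ₖ (1 : Matrix (Fin k) (Fin k) ℂ)) ψ‖ := by
    rw [smul_kronecker, map_smul, LinearMap.smul_apply, norm_smul]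
    simp
  have b5 : ‖Matrix.toEuclideanLin ((Z - T) ⊗ₖ (1 : Matrix (Fin k) (Fin k) ℂ)) ψ‖ ≤
      ‖Matrix.toEuclideanLin (C ⊗ₖ (1 : Matrix (Fin k) (Fin k) ℂ)) ψ‖ +
      ‖Matrix.toEuclideanLin ((O - T) ⊗ₖ (1 : Matrix (Fin k) (Fin k) ℂ)) ψ‖ := by
    rw [show Z - T = C + (O - T) by rw [hZCO]; abel, add_kronecker, map_add, LinearMap.add_apply]
    exact norm_add_le _ _
  have h0 : 0 ≤ ε := (norm_nonneg _).trans hac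
  have hs : 1 ≤ Real.sqrt (3 / 2) := by
    rw [Real.one_le_sqrt]; norm_num
  calc _ ≤ ε := by linarith
    _ ≤ _ := le_mul_of_one_le_left h0 hs
end

section
/- Let ρ be a density matrix on H_A ⊗ H_{A'} ⊗ H_B arising as a reduced state of a pure state on H_A ⊗ H_{A'} ⊗ H_B ⊗ H_{B'}. Then S(ρ_{AA'}) ≥ S(ρ_{A}) − S(ρ_{AB}), where S denotes von Neumann entropy and subscripts denote reduced states. -/
open Matrix

/-- The von Neumann entropy (base-2) of a Hermitian matrix, computed from its
eigenvalues (with the convention `0·log 0 = 0`). -/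
noncomputable def vnEntropy {n : Type*} [Fintype n] [DecidableEq n]
    {M : Matrix n n ℂ} (h : M.IsHermitian) : ℝ :=
  ∑ i, -(h.eigenvalues i * Real.logb 2 (h.eigenvalues i))

open scoped MatrixOrder ComplexOrder Matrix.Norms.L2Operator

variable {m n k : Type*} [Fintype m] [DecidableEq m] [Fintype n] [DecidableEq n] [Fintype k] [DecidableEq k]

noncomputable def liftHom (e : n ≃ m × k) : Matrix m m ℂ →⋆ₐ[ℂ] Matrix n n ℂ where
  toFun M := Matrix.of fun p q => if (e p).2 = (e q).2 then M (e p).1 (e q).1 else 0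
  map_one' := by
    ext p q
    simp only [Matrix.of_apply, Matrix.one_apply, ← ite_and]
    congr 1
    rw [← e.apply_eq_iff_eq (x := p), Prod.ext_iff, and_comm]
  map_zero' := by ext; simp
  map_add' A B := by
    ext p q
    simp only [Matrix.of_apply, Matrix.add_apply]
    split_ifs <;> simp
  map_mul' A B := by
    ext p q
    simp only [Matrix.of_apply, Matrix.mul_apply]
    rw [← e.symm.sum_comp, Fintype.sum_prod_type]
    simp only [Equiv.apply_symm_apply, ite_mul, zero_mul, mul_ite, mul_zero]
    split_ifs with h <;> simp [h]
  commutes' r := by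
    ext p q
    simp only [Matrix.of_apply, Matrix.algebraMap_matrix_apply, ← ite_and]
    congr 1
    rw [← e.apply_eq_iff_eq (x := p), Prod.ext_iff, and_comm]
  map_star' A := by
    ext p q
    simp only [Matrix.of_apply, Matrix.star_apply, eq_comm (a := (e p).2)]
    split_ifs <;> simp

noncomputable def ptr (e : n ≃ m × k) (τ : Matrix n n ℂ) : Matrix m m ℂ :=
  Matrix.of fun i j => ∑ l, τ (e.symm (i, l)) (e.symm (j, l))

lemma trace_ptr (e : n ≃ m × k) (τ : Matrix n n ℂ) (A : Matrix m m ℂ) :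
    (τ * liftHom e A).trace = (ptr e τ * A).trace := by
  simp only [Matrix.trace, Matrix.diag, Matrix.mul_apply]
  rw [← e.symm.sum_comp, Fintype.sum_prod_type]
  refine Finset.sum_congr rfl fun i _ => ?_
  have : ∀ l, ∑ j, τ (e.symm (i, l)) j * liftHom e A j (e.symm (i,l)) =
    ∑ j, τ (e.symm (i, l)) (e.symm (j, l)) * A j i := by
    intro l
    rw [← e.symm.sum_comp, Fintype.sum_prod_type]
    refine Finset.sum_congr rfl fun j _ => ?_
    simp [liftHom]
  simp only [this, ptr, Matrix.of_apply, Finset.sum_mul]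
  rw [Finset.sum_comm]

lemma log_liftHom (e : n ≃ m × k) (A : Matrix m m ℂ) (hA : A.IsHermitian) :
    CFC.log (liftHom e A) = liftHom e (CFC.log A) := by
  unfold CFC.log
  have h : IsSelfAdjoint A := hA
  refine ((liftHom e).map_cfc (R := ℝ) (S := ℂ) Real.log A ?_ ?_ h (h.map _)).symm
  · exact (Matrix.finite_real_spectrum (A := A)).continuousOn _
  · exact (liftHom e).toAlgHom.toLinearMap.continuous_of_finiteDimensional

lemma liftHom_pos (e : n ≃ m × k) (A : Matrix m m ℂ) (hA : IsStrictlyPositive A) :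
    IsStrictlyPositive (liftHom e A) := by
  refine ⟨map_nonneg _ hA.1, hA.2.map _⟩

lemma trace_log (e : n ≃ m × k) (τ : Matrix n n ℂ) (h : (ptr e τ).IsHermitian) :
    (τ * CFC.log (liftHom e (ptr e τ))).trace = (ptr e τ * CFC.log (ptr e τ)).trace := by
  rw [log_liftHom _ _ h, trace_ptr]

/-- Operator monotonicity of the logarithm, applied to `N K N ≤ L N`. -/
lemma log_step {K L N : Matrix n n ℂ} (hK : IsStrictlyPositive K) (hL : IsStrictlyPositive L)
    (hN : IsStrictlyPositive N) (hc : Commute L N) (h : N * K * N ≤ L * N) :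
    CFC.log K ≤ CFC.log L - CFC.log N := by
  have hN' : IsSelfAdjoint N := hN.1.isSelfAdjoint
  have hu := hN.2
  set E := NormedSpace.exp (-CFC.log N) with hE
  have h1 : N * E = 1 := by
    conv_lhs => rw [← CFC.exp_log N hN]
    rw [hE, ← Matrix.exp_add_of_commute _ _ ((Commute.refl (CFC.log N)).neg_right)]
    simp
  have h2 : E * N = 1 := by
    conv_lhs => rw [← CFC.exp_log N hN]
    rw [hE, ← Matrix.exp_add_of_commute _ _ ((Commute.refl (CFC.log N)).neg_left)]
    simp
  have hEs : star E = E := by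
    have : IsSelfAdjoint (-CFC.log N) := (IsSelfAdjoint.log).neg
    rw [hE, NormedSpace.star_exp, this.star_eq]
  have hcl : Commute (CFC.log L) (-CFC.log N) :=
    ((hc.cfc_real Real.log).symm.cfc_real Real.log).symm.neg_right
  have hle : K ≤ L * E := by
    have := star_left_conjugate_le_conjugate h E
    rw [hEs] at this
    have e1 : E * (N * K * N) * E = K := by
      calc _ = (E * N) * K * (N * E) := by noncomm_ring
        _ = K := by rw [h1, h2]; simp
    have e2 : E * (L * N) * E = L * E := by
      rw [hc.eq]
      calc _ = (E * N) * L * E := by noncomm_ring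
        _ = _ := by rw [h2]; simp
    rwa [e1, e2] at this
  have he : L * E = NormedSpace.exp (CFC.log L - CFC.log N) := by
    rw [sub_eq_add_neg, Matrix.exp_add_of_commute _ _ hcl, CFC.exp_log L hL]
  have := CFC.log_le_log hle hK
  rwa [he, CFC.log_exp _ (IsSelfAdjoint.log.sub IsSelfAdjoint.log)] at this

set_option linter.unusedSectionVars false

variable {X Y Z W : Type*} [Fintype X] [DecidableEq X] [Fintype Y] [DecidableEq Y]
  [Fintype Z] [DecidableEq Z] [Fintype W] [DecidableEq W]

abbrev exy (X Y Z : Type*) : X × Y × Z ≃ (X × Y) × Z := (Equiv.prodAssoc X Y Z).symm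
abbrev ex (X Y Z : Type*) : X × Y × Z ≃ X × (Y × Z) := Equiv.refl _
abbrev eyz (X Y Z : Type*) : X × Y × Z ≃ (Y × Z) × X := Equiv.prodComm X (Y × Z)

lemma lift_mul_apply (A : Matrix X X ℂ) (B : Matrix (Y × Z) (Y × Z) ℂ) (p q) :
    (liftHom (ex X Y Z) A * liftHom (eyz X Y Z) B) p q = A p.1 q.1 * B p.2 q.2 := by
  obtain ⟨x, p⟩ := p
  obtain ⟨x', p'⟩ := q
  rw [Matrix.mul_apply, Fintype.sum_prod_type, Finset.sum_eq_single x', Finset.sum_eq_single p]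
  · simp [liftHom]
  · intro b _ hb
    simp [liftHom, hb.symm]
  · simp
  · intro b _ hb
    simp [liftHom, hb]
  · simp

lemma lift_mul_apply' (A : Matrix X X ℂ) (B : Matrix (Y × Z) (Y × Z) ℂ) (p q) :
    (liftHom (eyz X Y Z) B * liftHom (ex X Y Z) A) p q = A p.1 q.1 * B p.2 q.2 := by
  obtain ⟨x, p⟩ := p
  obtain ⟨x', p'⟩ := q
  rw [Matrix.mul_apply, Fintype.sum_prod_type, Finset.sum_eq_single x, Finset.sum_eq_single p']
  · simp [liftHom, mul_comm]
  · intro b _ hb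
    simp [liftHom, hb]
  · simp
  · intro b _ hb
    simp [liftHom, hb.symm]
  · simp

lemma comm_lift (A : Matrix X X ℂ) (B : Matrix (Y × Z) (Y × Z) ℂ) :
    Commute (liftHom (ex X Y Z) A) (liftHom (eyz X Y Z) B) := by
  ext p q
  rw [lift_mul_apply, lift_mul_apply']

lemma trace_mul_nonneg {τ P : Matrix n n ℂ} (hτ : 0 ≤ τ) (hP : 0 ≤ P) :
    0 ≤ (τ * P).trace := by
  obtain ⟨M, rfl⟩ := CStarAlgebra.nonneg_iff_eq_mul_star_self.mp hτ
  rw [mul_assoc, Matrix.trace_mul_comm]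
  exact ((Matrix.nonneg_iff_posSemidef.mp hP).conjTranspose_mul_mul_same M).trace_nonneg

def Cm (M : Matrix (X × Y × Z) W ℂ) : Matrix (X × Y × Z) ((Z × W) × Z) ℂ :=
  Matrix.of fun p q => if p.2.2 = q.2 then M (p.1, p.2.1, q.1.1) q.1.2 else 0

def Gm (M : Matrix (X × Y × Z) W ℂ) : Matrix (X × Y × Z) ((Y × Z × W) × (X × W)) ℂ :=
  Matrix.of fun p q => M (p.1, q.1.1, q.1.2.1) q.1.2.2 * M (q.2.1, p.2.1, p.2.2) q.2.2

def Dm (M : Matrix (X × Y × Z) W ℂ) : Matrix ((Y × Z × W) × (X × W)) ((Z × W) × Z) ℂ :=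
  Matrix.of fun q r => if q.1.2 = r.1 then star (M (q.2.1, q.1.1, r.2) q.2.2) else 0

lemma Cm_mul (M : Matrix (X × Y × Z) W ℂ) :
    liftHom (exy X Y Z) (ptr (exy X Y Z) (M * Mᴴ)) = Cm M * (Cm M)ᴴ := by
  ext ⟨x, y, z⟩ ⟨x', y', z'⟩
  simp [liftHom, ptr, Cm, Matrix.mul_apply, Fintype.sum_prod_type, apply_ite (starRingEnd ℂ)]

lemma Gm_mul (M : Matrix (X × Y × Z) W ℂ) :
    liftHom (ex X Y Z) (ptr (ex X Y Z) (M * Mᴴ)) * liftHom (eyz X Y Z) (ptr (eyz X Y Z) (M * Mᴴ))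
      = Gm M * (Gm M)ᴴ := by
  ext ⟨x, y, z⟩ ⟨x', y', z'⟩
  rw [lift_mul_apply, Matrix.mul_apply, Fintype.sum_prod_type]
  have h1 : ptr (ex X Y Z) (M * Mᴴ) x x' =
      ∑ q : Y × Z × W, M (x, q.1, q.2.1) q.2.2 * star (M (x', q.1, q.2.1) q.2.2) := by
    simp [ptr, Matrix.mul_apply, Fintype.sum_prod_type]
  have h2 : ptr (eyz X Y Z) (M * Mᴴ) (y, z) (y', z') =
      ∑ q : X × W, M (q.1, y, z) q.2 * star (M (q.1, y', z') q.2) := by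
    simp [ptr, Matrix.mul_apply, Fintype.sum_prod_type]
  simp only [h1, h2, Finset.sum_mul_sum]
  refine Finset.sum_congr rfl fun q _ => Finset.sum_congr rfl fun r _ => ?_
  simp [Gm]
  ring

lemma Dm_mul (M : Matrix (X × Y × Z) W ℂ) :
    liftHom (eyz X Y Z) (ptr (eyz X Y Z) (M * Mᴴ)) * Cm M = Gm M * Dm M := by
  ext ⟨x, y, z⟩ ⟨⟨z', w'⟩, z2⟩
  have hL : (liftHom (eyz X Y Z) (ptr (eyz X Y Z) (M * Mᴴ)) * Cm M) (x, y, z) ((z', w'), z2) =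
      ∑ y2, (∑ q : X × W, M (q.1, y, z) q.2 * star (M (q.1, y2, z2) q.2)) *
        M (x, y2, z') w' := by
    rw [Matrix.mul_apply, Fintype.sum_prod_type, Finset.sum_eq_single x, Fintype.sum_prod_type]
    · refine Finset.sum_congr rfl fun y2 _ => ?_
      rw [Finset.sum_eq_single z2]
      · simp [liftHom, ptr, Cm, Matrix.mul_apply, Fintype.sum_prod_type]
      · intro b _ hb
        simp [Cm, hb]
      · simp
    · intro b _ hb
      simp [liftHom, hb.symm]
    · simp
  have hR : (Gm M * Dm M) (x, y, z) ((z', w'), z2) =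
      ∑ y2, ∑ q : X × W, (M (x, y2, z') w' * M (q.1, y, z) q.2) *
        star (M (q.1, y2, z2) q.2) := by
    rw [Matrix.mul_apply, Fintype.sum_prod_type, Fintype.sum_prod_type]
    refine Finset.sum_congr rfl fun y2 _ => ?_
    rw [Finset.sum_eq_single (z', w')]
    · simp [Gm, Dm]
    · intro b _ hb
      simp [Dm, hb]
    · simp
  rw [hL, hR]
  refine Finset.sum_congr rfl fun y2 _ => ?_
  rw [Finset.sum_mul]
  refine Finset.sum_congr rfl fun q _ => ?_
  ring

lemma hsq {ι : Type*} [Fintype ι] (v : ι → ℂ) :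
    star v ⬝ᵥ v = ((∑ i, ‖v i‖ ^ 2 : ℝ) : ℂ) := by
  simp [dotProduct, Complex.conj_mul']

lemma Dm_le (M : Matrix (X × Y × Z) W ℂ) (h : ∑ p, ∑ w, ‖M p w‖ ^ 2 ≤ 1) :
    Dm M * (Dm M)ᴴ ≤ 1 := by
  rw [Matrix.le_iff]
  refine Matrix.PosSemidef.of_dotProduct_mulVec_nonneg
    (Matrix.isHermitian_one.sub (Matrix.isHermitian_mul_conjTranspose_self _)) fun k => ?_
  have h1 : star k ⬝ᵥ (Dm M * (Dm M)ᴴ) *ᵥ k =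
      star ((Dm M)ᴴ *ᵥ k) ⬝ᵥ ((Dm M)ᴴ *ᵥ k) := by
    rw [Matrix.star_mulVec, Matrix.conjTranspose_conjTranspose, ← Matrix.dotProduct_mulVec,
      Matrix.mulVec_mulVec]
  rw [Matrix.sub_mulVec, dotProduct_sub, Matrix.one_mulVec, h1, hsq, hsq, ← Complex.ofReal_sub,
    Complex.zero_le_real, sub_nonneg]
  have hent : ∀ r, ((Dm M)ᴴ *ᵥ k) r =
      ∑ s : Y × X × W, M (s.2.1, s.1, r.2) s.2.2 * k ((s.1, r.1), s.2) := by
    intro r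
    simp only [Matrix.mulVec, dotProduct]
    rw [Fintype.sum_prod_type, Fintype.sum_prod_type, Fintype.sum_prod_type]
    refine Finset.sum_congr rfl fun y2 _ => ?_
    rw [Finset.sum_eq_single r.1]
    · simp [Dm]
    · intro b _ hb
      simp [Dm, hb]
    · simp
  have hcs : ∀ r, ‖((Dm M)ᴴ *ᵥ k) r‖ ^ 2 ≤
      (∑ s : Y × X × W, ‖M (s.2.1, s.1, r.2) s.2.2‖ ^ 2) *
      ∑ s : Y × X × W, ‖k ((s.1, r.1), s.2)‖ ^ 2 := by
    intro r
    rw [hent]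
    refine le_trans ?_ (Finset.sum_mul_sq_le_sq_mul_sq _ _ _)
    gcongr
    refine (norm_sum_le _ _).trans (le_of_eq ?_)
    simp
  refine (Finset.sum_le_sum fun r _ => hcs r).trans ?_
  rw [Fintype.sum_prod_type, Finset.sum_comm]
  simp only [← Finset.mul_sum]
  rw [← Finset.sum_mul]
  have e1 : ∑ z, ∑ s : Y × X × W, ‖M (s.2.1, s.1, z) s.2.2‖ ^ 2 = ∑ p, ∑ w, ‖M p w‖ ^ 2 := by
    simp only [Fintype.sum_prod_type]
    rw [Finset.sum_comm' (t' := Finset.univ) (s' := fun _ => Finset.univ) (by simp)]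
    rw [Finset.sum_comm' (s := Finset.univ (α := X)) (t' := Finset.univ) (s' := fun _ => Finset.univ) (by simp)]
    refine Finset.sum_congr rfl fun y _ => ?_
    rw [Finset.sum_comm]
  have e2 : ∑ q : Z × W, ∑ s : Y × X × W, ‖k ((s.1, q), s.2)‖ ^ 2 = ∑ i, ‖k i‖ ^ 2 := by
    rw [Finset.sum_comm]
    simp only [Fintype.sum_prod_type (α₁ := Y), Fintype.sum_prod_type (α₁ := Y × Z × W)]
    refine Finset.sum_congr rfl fun y _ => ?_
    rw [Finset.sum_comm]
  rw [e1, e2]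
  have : 0 ≤ ∑ i, ‖k i‖ ^ 2 := Finset.sum_nonneg fun _ _ => by positivity
  nlinarith

lemma core (M : Matrix (X × Y × Z) W ℂ) (h : ∑ p, ∑ w, ‖M p w‖ ^ 2 ≤ 1) :
    liftHom (eyz X Y Z) (ptr (eyz X Y Z) (M * Mᴴ)) * liftHom (exy X Y Z) (ptr (exy X Y Z) (M * Mᴴ))
      * liftHom (eyz X Y Z) (ptr (eyz X Y Z) (M * Mᴴ)) ≤
    liftHom (ex X Y Z) (ptr (ex X Y Z) (M * Mᴴ)) *
      liftHom (eyz X Y Z) (ptr (eyz X Y Z) (M * Mᴴ)) := by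
  have hN : (liftHom (eyz X Y Z) (ptr (eyz X Y Z) (M * Mᴴ)))ᴴ =
      liftHom (eyz X Y Z) (ptr (eyz X Y Z) (M * Mᴴ)) := by
    rw [← Matrix.star_eq_conjTranspose, ← map_star]
    congr 1
    ext i j
    simp [ptr, Matrix.mul_apply, mul_comm]
  rw [Gm_mul, Cm_mul]
  have e : liftHom (eyz X Y Z) (ptr (eyz X Y Z) (M * Mᴴ)) * (Cm M * (Cm M)ᴴ) *
      liftHom (eyz X Y Z) (ptr (eyz X Y Z) (M * Mᴴ)) = Gm M * (Dm M * (Dm M)ᴴ) * (Gm M)ᴴ := by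
    conv_lhs => rw [← Matrix.mul_assoc, Matrix.mul_assoc]; rhs; rw [← hN, ← Matrix.conjTranspose_mul]
    rw [Dm_mul]
    simp [Matrix.mul_assoc]
  rw [e, Matrix.le_iff]
  have := ((Matrix.le_iff.mp (Dm_le M h))).mul_mul_conjTranspose_same (Gm M)
  simpa [Matrix.mul_sub, Matrix.sub_mul] using this

lemma ptr_posSemidef (e : n ≃ m × k) {τ : Matrix n n ℂ} (hτ : 0 ≤ τ) : (ptr e τ).PosSemidef := by
  obtain ⟨M, rfl⟩ := CStarAlgebra.nonneg_iff_eq_mul_star_self.mp hτ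
  have : ptr e (M * star M) = (Matrix.of fun i (q : k × n) => M (e.symm (i, q.1)) q.2) *
      (Matrix.of fun i (q : k × n) => M (e.symm (i, q.1)) q.2)ᴴ := by
    ext i j
    simp [ptr, Matrix.mul_apply, Fintype.sum_prod_type]
  rw [this]
  exact Matrix.posSemidef_self_mul_conjTranspose _

lemma main_pd {τ : Matrix (X × Y × Z) (X × Y × Z) ℂ} (hτ : 0 ≤ τ) (htr : τ.trace.re ≤ 1)
    (hK : (ptr (exy X Y Z) τ).PosDef) (hL : (ptr (ex X Y Z) τ).PosDef)
    (hN : (ptr (eyz X Y Z) τ).PosDef) :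
    (ptr (exy X Y Z) τ * CFC.log (ptr (exy X Y Z) τ)).trace.re +
    (ptr (eyz X Y Z) τ * CFC.log (ptr (eyz X Y Z) τ)).trace.re ≤
    (ptr (ex X Y Z) τ * CFC.log (ptr (ex X Y Z) τ)).trace.re := by
  obtain ⟨M, hM⟩ := CStarAlgebra.nonneg_iff_eq_mul_star_self.mp hτ
  rw [Matrix.star_eq_conjTranspose] at hM
  have hM1 : ∑ p, ∑ w, ‖M p w‖ ^ 2 ≤ 1 := by
    refine le_trans (le_of_eq ?_) htr
    rw [hM]
    simp [Matrix.trace, Matrix.mul_apply, Complex.mul_conj', ← Complex.ofReal_pow]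
  have hc := core M hM1
  rw [← hM] at hc
  have hl := log_step (liftHom_pos _ _ (Matrix.isStrictlyPositive_iff_posDef.mpr hK))
    (liftHom_pos _ _ (Matrix.isStrictlyPositive_iff_posDef.mpr hL))
    (liftHom_pos _ _ (Matrix.isStrictlyPositive_iff_posDef.mpr hN)) (comm_lift _ _) hc
  have := trace_mul_nonneg hτ (sub_nonneg.mpr hl)
  rw [mul_sub, mul_sub, Matrix.trace_sub, Matrix.trace_sub, trace_log _ _ hK.1,
    trace_log _ _ hL.1, trace_log _ _ hN.1] at this
  have := (Complex.le_def.mp this).1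
  simp at this
  linarith

lemma trace_cfc {A : Matrix n n ℂ} (hA : A.IsHermitian) (f : ℝ → ℝ) :
    (cfc f A).trace.re = ∑ i, f (hA.eigenvalues i) := by
  rw [hA.cfc_eq, Matrix.IsHermitian.cfc, Unitary.conjStarAlgAut_apply, Matrix.trace_mul_comm,
    ← mul_assoc]
  simp [Matrix.trace]

lemma ent_affine {A : Matrix n n ℂ} (hA : A.IsHermitian) (c d : ℝ) :
    (((c : ℂ) • A + (d : ℂ) • 1) * CFC.log ((c : ℂ) • A + (d : ℂ) • 1)).trace.re =
      ∑ i, (c * hA.eigenvalues i + d) * Real.log (c * hA.eigenvalues i + d) := by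
  have hs : IsSelfAdjoint A := hA
  have hco : ∀ (B : Matrix n n ℂ) (f : ℝ → ℝ), ContinuousOn f (spectrum ℝ B) := fun B f =>
    (Matrix.finite_real_spectrum (A := B)).continuousOn _
  have h1 : (c : ℂ) • A + (d : ℂ) • 1 = cfc (fun x : ℝ => c * x + d) A := by
    rw [cfc_add_const _ _ _ (hco _ _), cfc_const_mul_id _ _, Algebra.algebraMap_eq_smul_one]
    rfl
  have h2 : (cfc (fun x : ℝ => c * x + d) A) * CFC.log (cfc (fun x : ℝ => c * x + d) A) =
      cfc (fun x : ℝ => (c * x + d) * Real.log (c * x + d)) A := by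
    have h3 : CFC.log (cfc (fun x : ℝ => c * x + d) A) =
        cfc (fun x : ℝ => Real.log (c * x + d)) A := by
      unfold CFC.log
      rw [← cfc_comp' Real.log (fun x : ℝ => c * x + d) A
        (((Matrix.finite_real_spectrum (A := A)).image _).continuousOn _) (hco _ _)]
    rw [h3, ← cfc_mul _ _ _ (hco _ _) (hco _ _)]
  rw [h1, h2, trace_cfc hA]

lemma ptr_affine (e : n ≃ m × k) (τ : Matrix n n ℂ) (c d : ℝ) :
    ptr e ((c : ℂ) • τ + (d : ℂ) • 1) =
      (c : ℂ) • ptr e τ + ((d * Fintype.card k : ℝ) : ℂ) • 1 := by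
  ext i j
  simp [ptr, Matrix.one_apply, Finset.sum_add_distrib, Finset.mul_sum]
  split_ifs <;> simp [mul_comm]

lemma tendsto_ent {A : Matrix n n ℂ} (hA : A.IsHermitian) (r : ℝ) :
    Filter.Tendsto (fun δ : ℝ => ∑ i, ((1 - δ) * hA.eigenvalues i + δ * r) *
      Real.log ((1 - δ) * hA.eigenvalues i + δ * r)) (nhdsWithin 0 (Set.Ioi 0))
      (nhds (∑ i, hA.eigenvalues i * Real.log (hA.eigenvalues i))) := by
  have : Continuous (fun δ : ℝ => ∑ i, ((1 - δ) * hA.eigenvalues i + δ * r) *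
      Real.log ((1 - δ) * hA.eigenvalues i + δ * r)) := by
    refine continuous_finsetSum _ fun i _ => ?_
    exact Real.continuous_mul_log.comp (g := fun x : ℝ => x * Real.log x)
      (f := fun δ : ℝ => (1 - δ) * hA.eigenvalues i + δ * r) (by fun_prop)
  have := (this.tendsto 0).mono_left (nhdsWithin_le_nhds (s := Set.Ioi 0))
  simpa using this

lemma posDef_affine {A : Matrix n n ℂ} (hA : A.PosSemidef) {c d : ℝ} (hc : 0 ≤ c) (hd : 0 < d) :
    ((c : ℂ) • A + (d : ℂ) • 1).PosDef := by
  refine Matrix.PosDef.posSemidef_add (hA.smul (by exact_mod_cast hc)) ?_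
  exact Matrix.PosDef.one.smul (by exact_mod_cast hd)

lemma main_ineq {τ : Matrix (X × Y × Z) (X × Y × Z) ℂ} (hτ : 0 ≤ τ) (htr : τ.trace = 1)
    (hK : (ptr (exy X Y Z) τ).IsHermitian) (hL : (ptr (ex X Y Z) τ).IsHermitian)
    (hN : (ptr (eyz X Y Z) τ).IsHermitian) :
    ∑ i, hK.eigenvalues i * Real.log (hK.eigenvalues i) +
    ∑ i, hN.eigenvalues i * Real.log (hN.eigenvalues i) ≤
    ∑ i, hL.eigenvalues i * Real.log (hL.eigenvalues i) := by
  have hne : Nonempty (X × Y × Z) := by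
    by_contra h
    rw [not_nonempty_iff] at h
    simp [Matrix.trace] at htr
  obtain ⟨x0, y0, z0⟩ := hne
  have : Nonempty X := ⟨x0⟩
  have : Nonempty Y := ⟨y0⟩
  have : Nonempty Z := ⟨z0⟩
  set D : ℝ := (Fintype.card (X × Y × Z) : ℝ) with hD
  have hD0 : 0 < D := by rw [hD]; exact_mod_cast Fintype.card_pos
  refine le_of_tendsto_of_tendsto ((tendsto_ent hK (D⁻¹ * Fintype.card Z)).add
    (tendsto_ent hN (D⁻¹ * Fintype.card X))) (tendsto_ent hL (D⁻¹ * Fintype.card (Y × Z))) ?_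
  filter_upwards [Ioo_mem_nhdsGT (show (0 : ℝ) < 1 by norm_num)] with δ hδ
  have hc : 0 ≤ 1 - δ := by linarith [hδ.2]
  have hX : 0 < δ * (D⁻¹ * (Fintype.card X : ℝ)) := by
    have : (0 : ℝ) < Fintype.card X := by exact_mod_cast Fintype.card_pos
    have := hδ.1
    positivity
  have hZ : 0 < δ * (D⁻¹ * (Fintype.card Z : ℝ)) := by
    have : (0 : ℝ) < Fintype.card Z := by exact_mod_cast Fintype.card_pos
    have := hδ.1
    positivity
  have hYZ : 0 < δ * (D⁻¹ * (Fintype.card (Y × Z) : ℝ)) := by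
    have : (0 : ℝ) < Fintype.card (Y × Z) := by exact_mod_cast Fintype.card_pos
    have := hδ.1
    positivity
  have hpos : 0 < δ * D⁻¹ := mul_pos hδ.1 (inv_pos.mpr hD0)
  have h0 : 0 ≤ ((1 - δ : ℝ) : ℂ) • τ + ((δ * D⁻¹ : ℝ) : ℂ) • 1 :=
    Matrix.nonneg_iff_posSemidef.mpr
      (posDef_affine (Matrix.nonneg_iff_posSemidef.mp hτ) hc hpos).posSemidef
  have ht : (((1 - δ : ℝ) : ℂ) • τ + ((δ * D⁻¹ : ℝ) : ℂ) • 1).trace.re ≤ 1 := by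
    rw [Matrix.trace_add, Matrix.trace_smul, Matrix.trace_smul, htr, Matrix.trace_one]
    have : (((1 - δ : ℝ) : ℂ) • (1 : ℂ) + ((δ * D⁻¹ : ℝ) : ℂ) • (Fintype.card (X × Y × Z) : ℂ)) =
        ((1 - δ + δ * D⁻¹ * D : ℝ) : ℂ) := by
      rw [hD]
      push_cast
      simp
    rw [this, Complex.ofReal_re, mul_assoc, inv_mul_cancel₀ hD0.ne']
    linarith
  have key := main_pd h0 ht
  simp only [ptr_affine, ent_affine hK, ent_affine hL, ent_affine hN, mul_assoc] at key
  exact key (posDef_affine (ptr_posSemidef _ hτ) hc hZ) (posDef_affine (ptr_posSemidef _ hτ) hc hYZ)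
    (posDef_affine (ptr_posSemidef _ hτ) hc hX)

lemma sum_eig_eq (V : Matrix m n ℂ) {A : Matrix m m ℂ} {B : Matrix n n ℂ} (hA : A.IsHermitian)
    (hB : B.IsHermitian) (eA : A = V * Vᴴ) (eB : B = (Vᴴ * V)ᵀ) (f : ℝ → ℝ) (f0 : f 0 = 0) :
    ∑ i, f (hA.eigenvalues i) = ∑ i, f (hB.eigenvalues i) := by
  have h := Matrix.charpoly_mul_comm' V Vᴴ
  rw [← eA, ← Matrix.charpoly_transpose (Vᴴ * V), ← eB] at h
  have h2 := congrArg Polynomial.roots h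
  rw [Polynomial.roots_mul (mul_ne_zero (pow_ne_zero _ Polynomial.X_ne_zero)
      (Matrix.charpoly_monic _).ne_zero),
    Polynomial.roots_mul (mul_ne_zero (pow_ne_zero _ Polynomial.X_ne_zero)
      (Matrix.charpoly_monic _).ne_zero), hA.roots_charpoly_eq_eigenvalues,
    hB.roots_charpoly_eq_eigenvalues] at h2
  have h3 := congrArg (fun s => (s.map (fun z : ℂ => f z.re)).sum) h2
  simpa [f0, Multiset.map_nsmul, Multiset.sum_nsmul] using h3

/-- Strong subadditivity in the form used in the entropy lower
bound: for reduced states of a pure state on `A ⊗ A' ⊗ B ⊗ B'`,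
`S(ρ_{AA'}) ≥ S(ρ_A) − S(ρ_{AB})`. -/
theorem stmt12 {a a' b b' : ℕ}
    (ψ : EuclideanSpace ℂ ((Fin a × Fin a') × (Fin b × Fin b'))) (hψ : ‖ψ‖ = 1)
    (ρAA' : Matrix (Fin a × Fin a') (Fin a × Fin a') ℂ)
    (hρAA' : ρAA' = Matrix.of fun p q => ∑ w : Fin b × Fin b',
      ψ (p, w) * (starRingEnd ℂ) (ψ (q, w)))
    (ρA : Matrix (Fin a) (Fin a) ℂ)
    (hρA : ρA = Matrix.of fun i j => ∑ y : Fin a', ∑ w : Fin b × Fin b',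
      ψ ((i, y), w) * (starRingEnd ℂ) (ψ ((j, y), w)))
    (ρAB : Matrix (Fin a × Fin b) (Fin a × Fin b) ℂ)
    (hρAB : ρAB = Matrix.of fun p q => ∑ y : Fin a', ∑ w' : Fin b',
      ψ ((p.1, y), (p.2, w')) * (starRingEnd ℂ) (ψ ((q.1, y), (q.2, w'))))
    (h1 : ρAA'.IsHermitian) (h2 : ρA.IsHermitian) (h3 : ρAB.IsHermitian) :
    vnEntropy h1 ≥ vnEntropy h2 - vnEntropy h3 := by

  have hnorm : ∑ p, ‖ψ p‖ ^ 2 = 1 := by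
    rw [← EuclideanSpace.norm_sq_eq, hψ]; norm_num
  let M : Matrix (Fin a × Fin a' × Fin b') (Fin b) ℂ :=
    Matrix.of fun p w => ψ ((p.1, p.2.1), (w, p.2.2))
  have hτ : 0 ≤ M * Mᴴ := Matrix.nonneg_iff_posSemidef.mpr
    (Matrix.posSemidef_self_mul_conjTranspose M)
  have htr : (M * Mᴴ).trace = 1 := by
    have : (M * Mᴴ).trace = ((∑ p, ‖ψ p‖ ^ 2 : ℝ) : ℂ) := by
      simp only [Matrix.trace, Matrix.diag, Matrix.mul_apply, Fintype.sum_prod_type]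
      push_cast
      refine Finset.sum_congr rfl fun i _ => Finset.sum_congr rfl fun j _ => ?_
      rw [Finset.sum_comm]
      simp [M, Complex.mul_conj']
    rw [this, hnorm]; simp
  have eK : ptr (exy _ _ _) (M * Mᴴ) = ρAA' := by
    rw [hρAA']
    ext p q
    simp only [ptr, Matrix.of_apply, Matrix.mul_apply, Fintype.sum_prod_type]
    rw [Finset.sum_comm]
    simp [M]
  have eL : ptr (ex _ _ _) (M * Mᴴ) = ρA := by
    rw [hρA]
    ext p q
    simp only [ptr, Matrix.of_apply, Matrix.mul_apply, Fintype.sum_prod_type]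
    refine Finset.sum_congr rfl fun i _ => ?_
    rw [Finset.sum_comm]
    simp [M]
  let V : Matrix (Fin a × Fin b) (Fin a' × Fin b') ℂ :=
    Matrix.of fun p q => ψ ((p.1, q.1), (p.2, q.2))
  have eA : ρAB = V * Vᴴ := by
    rw [hρAB]
    ext p q
    simp [V, Matrix.mul_apply, Fintype.sum_prod_type]
  have eN : ptr (eyz _ _ _) (M * Mᴴ) = (Vᴴ * V)ᵀ := by
    ext p q
    simp [ptr, M, V, Matrix.mul_apply, Fintype.sum_prod_type, mul_comm]
  have hN : (ptr (eyz _ _ _) (M * Mᴴ)).IsHermitian := (ptr_posSemidef _ hτ).1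
  subst eK eL
  have key := main_ineq hτ htr h1 h2 hN
  rw [← sum_eig_eq V h3 hN eA eN (fun x => x * Real.log x) (by simp)] at key
  have hv : ∀ {n : Type} [Fintype n] [DecidableEq n] {A : Matrix n n ℂ} (h : A.IsHermitian),
      vnEntropy h = -(∑ i, h.eigenvalues i * Real.log (h.eigenvalues i)) / Real.log 2 := by
    intro n _ _ A h
    simp only [vnEntropy, Real.logb, ← Finset.sum_neg_distrib, Finset.sum_div]
    refine Finset.sum_congr rfl fun i _ => ?_
    ring
  rw [hv, hv, hv, ge_iff_le, ← sub_div]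
  have : 0 < Real.log 2 := Real.log_pos (by norm_num)
  gcongr
  linarith
end
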